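/- arXiv:2412.10375 — 3 statements merged into one kernel-verified Lean document; each statement's English description precedes it below -/
import Mathlib

section
/- Let A ∈ M_{n₁}(ℝ₊), B ∈ M_{n₂}(ℝ₊), and let C = diag(A, B) ∈ M_{n₁+n₂}(ℝ₊) be the block-diagonal matrix with blocks A and B. Then for every 1 ≤ k ≤ min{n₁, n₂}, Λ_k^max(A) ∪ Λ_k^max(B) ⊆ Λ_k^max(C). -/
open Matrix

namespace MaxAlg

variable {I J K : Type*}

/-- Entrywise nonnegative matrix (matrix over `ℝ₊`). -/
def Nonneg (A : Matrix I J ℝ) : Prop := ∀ i j, 0 ≤ A i j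

/-- Max-algebra matrix product: `(A ⊗ B) i k = max_j (A i j * B j k)`. -/
noncomputable def maxMul [Fintype J] (A : Matrix I J ℝ) (B : Matrix J K ℝ) :
    Matrix I K ℝ :=
  Matrix.of fun i k => ⨆ j, A i j * B j k

/-- Max trace: `tr_⊗(M) = max_i M i i`. -/
noncomputable def maxTrace (M : Matrix I I ℝ) : ℝ := ⨆ i, M i i

/-- Max isometry: a nonnegative matrix `X` with `Xᵗ ⊗ X = I`. -/
def IsMaxIsometry [Fintype I] [Fintype J] [DecidableEq J] (X : Matrix I J ℝ) : Prop :=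
  Nonneg X ∧ maxMul Xᵀ X = 1

/-- Max numerical range `W_max(A) = {xᵗ⊗A⊗x : x ∈ ℝ₊ⁿ, xᵗ⊗x = 1}`,
vectors being treated as `n × 1` matrices. -/
noncomputable def WMax [Fintype I] (A : Matrix I I ℝ) : Set ℝ :=
  {r | ∃ x : Matrix I (Fin 1) ℝ, Nonneg x ∧ maxMul xᵀ x = 1 ∧
    r = maxMul xᵀ (maxMul A x) 0 0}

/-- Max rank-`k` numerical range
`Λ_k^max(A) = {λ ∈ ℝ₊ : Xᵗ⊗A⊗X = λ I_k for some max isometry X}`. -/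
noncomputable def LambdaMax [Fintype I] (k : ℕ) (A : Matrix I I ℝ) : Set ℝ :=
  {lam | 0 ≤ lam ∧ ∃ X : Matrix I (Fin k) ℝ, IsMaxIsometry X ∧
    maxMul Xᵀ (maxMul A X) = lam • (1 : Matrix (Fin k) (Fin k) ℝ)}

/-- Max `k`-numerical range `W_max^k(A) = {tr_⊗(Xᵗ⊗A⊗X) : X ∈ 𝒳_{n×k}}`. -/
noncomputable def WMaxK [Fintype I] (k : ℕ) (A : Matrix I I ℝ) : Set ℝ :=
  {r | ∃ X : Matrix I (Fin k) ℝ, IsMaxIsometry X ∧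
    r = maxTrace (maxMul Xᵀ (maxMul A X))}

/-- Max joint `k`-numerical range of an `m`-tuple of matrices. -/
noncomputable def WMaxKJoint [Fintype I] {m : ℕ} (k : ℕ)
    (A : Fin m → Matrix I I ℝ) : Set (Fin m → ℝ) :=
  {v | ∃ X : Matrix I (Fin k) ℝ, IsMaxIsometry X ∧
    ∀ l, v l = maxTrace (maxMul Xᵀ (maxMul (A l) X))}

/-- Sup-norm of a real matrix: maximum absolute value of an entry. -/
noncomputable def matNorm (M : Matrix I J ℝ) : ℝ := ⨆ i, ⨆ j, |M i j|

/-- Sup-norm of a real vector: maximum absolute value of an entry. -/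
noncomputable def vecNorm (v : I → ℝ) : ℝ := ⨆ i, |v i|

/-- Entrywise maximum (`max sum`) of two matrices. -/
def maxAdd (A B : Matrix I J ℝ) : Matrix I J ℝ :=
  Matrix.of fun i j => max (A i j) (B i j)

/-- Max joint `c`-numerical range of an `m`-tuple of matrices:
`{(max_i c_i (xᵢᵗ⊗A₁⊗xᵢ), …) : X = [x₁,…,xₙ] max unitary}`; note that
`xᵢᵗ⊗A⊗xᵢ` is the `(i,i)` entry of `Xᵗ⊗A⊗X`. -/
noncomputable def WMaxCJoint {n m : ℕ} (c : Fin n → ℝ)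
    (A : Fin m → Matrix (Fin n) (Fin n) ℝ) : Set (Fin m → ℝ) :=
  {v | ∃ U : Matrix (Fin n) (Fin n) ℝ, IsMaxIsometry U ∧
    ∀ l, v l = ⨆ i, c i * maxMul Uᵀ (maxMul (A l) U) i i}

/-- Max joint `C`-numerical range of an `m`-tuple of matrices:
`{(tr_⊗(C⊗Xᵗ⊗A₁⊗X), …) : X max unitary}`. -/
noncomputable def WMaxBigCJoint {n m : ℕ} (C : Matrix (Fin n) (Fin n) ℝ)
    (A : Fin m → Matrix (Fin n) (Fin n) ℝ) : Set (Fin m → ℝ) :=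
  {v | ∃ X : Matrix (Fin n) (Fin n) ℝ, IsMaxIsometry X ∧
    ∀ l, v l = maxTrace (maxMul C (maxMul Xᵀ (maxMul (A l) X)))}

theorem iSup_eq_iSup_comp_of_eq_zero [Finite I] [Finite J] {e : I → J} {f : J → ℝ}
    (hf : ∀ i, 0 ≤ f (e i)) (h0 : ∀ j, j ∉ Set.range e → f j = 0) :
    ⨆ j, f j = ⨆ i, f (e i) := by
  apply le_antisymm
  · refine Real.iSup_le (fun j => ?_) (Real.iSup_nonneg hf)
    by_cases hj : j ∈ Set.range e
    · obtain ⟨i, rfl⟩ := hj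
      exact le_ciSup (f := fun i => f (e i)) (Set.finite_range _).bddAbove i
    · rw [h0 j hj]
      exact Real.iSup_nonneg hf
  · refine Real.iSup_le (fun i => le_ciSup (Set.finite_range _).bddAbove (e i))
      (Real.iSup_nonneg fun j => ?_)
    by_cases hj : j ∈ Set.range e
    · obtain ⟨i, rfl⟩ := hj
      exact hf i
    · rw [h0 j hj]

theorem Nonneg.maxMul [Fintype J] {A : Matrix I J ℝ} {B : Matrix J K ℝ}
    (hA : Nonneg A) (hB : Nonneg B) : Nonneg (maxMul A B) :=
  fun i k => Real.iSup_nonneg fun j => mul_nonneg (hA i j) (hB j k)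

/-- Extend a matrix by zero rows outside the range of `e`. -/
noncomputable def extendRows (e : I → J) (X : Matrix I K ℝ) : Matrix J K ℝ :=
  Function.extend e X (0 : J → K → ℝ)

theorem extendRows_apply {e : I → J} (he : Function.Injective e) (X : Matrix I K ℝ) (i : I) :
    extendRows e X (e i) = X i :=
  he.extend_apply X (0 : J → K → ℝ) i

theorem extendRows_of_notMem_range {e : I → J} (X : Matrix I K ℝ) {j : J}
    (hj : j ∉ Set.range e) : extendRows e X j = 0 :=
  Function.extend_apply' X (0 : J → K → ℝ) j hj

theorem Nonneg.extendRows {e : I → J} (he : Function.Injective e) {X : Matrix I K ℝ}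
    (hX : Nonneg X) : Nonneg (extendRows e X) := by
  intro j k
  by_cases hj : j ∈ Set.range e
  · obtain ⟨i, rfl⟩ := hj
    rw [extendRows_apply he]
    exact hX i k
  · rw [extendRows_of_notMem_range X hj]
    rfl

theorem maxMul_extendRows {L : Type*} [Fintype I] [Fintype J] {e : I → J}
    (he : Function.Injective e) {M : Matrix L J ℝ} (hM : Nonneg M) {X : Matrix I K ℝ}
    (hX : Nonneg X) : maxMul M (extendRows e X) = maxMul (M.submatrix id e) X := by
  ext l k
  simp only [maxMul, of_apply]
  rw [iSup_eq_iSup_comp_of_eq_zero (e := e)]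
  · simp only [extendRows_apply he, submatrix_apply, id]
  · exact fun i => mul_nonneg (hM _ _) (hX.extendRows he _ _)
  · intro j hj
    simp [extendRows_of_notMem_range X hj]

theorem maxMul_transpose_extendRows {L : Type*} [Fintype I] [Fintype J] {e : I → J}
    (he : Function.Injective e) {M : Matrix J L ℝ} (hM : Nonneg M) {X : Matrix I K ℝ}
    (hX : Nonneg X) : maxMul (extendRows e X)ᵀ M = maxMul Xᵀ (M.submatrix e id) := by
  ext k l
  simp only [maxMul, of_apply]
  rw [iSup_eq_iSup_comp_of_eq_zero (e := e)]
  · simp only [transpose_apply, extendRows_apply he, submatrix_apply, id]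
  · exact fun i => mul_nonneg (hX.extendRows he _ _) (hM _ _)
  · intro j hj
    simp [extendRows_of_notMem_range X hj]

/-- The max rank-`k` numerical range of a principal submatrix is contained in that of the
whole matrix. -/
theorem lambdaMax_submatrix_subset [Fintype I] [Fintype J] {e : I → J}
    (he : Function.Injective e) {C : Matrix J J ℝ} (hC : Nonneg C) (k : ℕ) :
    LambdaMax k (C.submatrix e e) ⊆ LambdaMax k C := by
  rintro r ⟨hr, X, ⟨hX, hXX⟩, h⟩
  have hY := hX.extendRows he
  refine ⟨hr, extendRows e X, ⟨hY, ?_⟩, ?_⟩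
  · rw [maxMul_transpose_extendRows he hY hX, ← hXX]
    congr 1
    ext i j
    simp only [submatrix_apply, id, extendRows_apply he]
  · rw [maxMul_transpose_extendRows he (hC.maxMul hY) hX, maxMul_extendRows he hC hX, ← h]
    rfl

/-- `Λ_k^max(A) ∪ Λ_k^max(B) ⊆ Λ_k^max(diag(A,B))` for `1 ≤ k ≤ min{n₁,n₂}`. -/
theorem lambdaMax_union_subset_blockDiag {n₁ n₂ : ℕ}
    (A : Matrix (Fin n₁) (Fin n₁) ℝ) (B : Matrix (Fin n₂) (Fin n₂) ℝ)
    (hA : Nonneg A) (hB : Nonneg B) {k : ℕ}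
    (hk1 : 1 ≤ k) (hkmin : k ≤ min n₁ n₂) :
    LambdaMax k A ∪ LambdaMax k B ⊆
      LambdaMax k (Matrix.fromBlocks A 0 0 B) := by
  have hC : Nonneg (Matrix.fromBlocks A 0 0 B) := by
    rintro (i | i) (j | j)
    · exact hA i j
    · exact le_rfl
    · exact le_rfl
    · exact hB i j
  exact Set.union_subset (lambdaMax_submatrix_subset Sum.inl_injective hC k)
    (lambdaMax_submatrix_subset Sum.inr_injective hC k)


end MaxAlg
end

section
/- Let 1 ≤ k < n and let A = diag(A₁, …, A_k) ∈ M_n(ℝ₊) be block-diagonal with blocks A_i ∈ M_{n_i}(ℝ₊), i = 1, …, k, where n = n₁ + … + n_k. If W_max(A₁) = W_max(A₂) = … = W_max(A_k), then W_max(A) = W_max^k(A); consequently, W_max(A) = W_max^m(A) for every 1 ≤ m ≤ k. -/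
open Matrix

namespace MaxAlg

variable {I J K : Type*}

section MaxQuad

/-- The max quadratic form `xᵗ ⊗ A ⊗ x`. -/
noncomputable def maxQuad (A : Matrix I I ℝ) (x : I → ℝ) : ℝ :=
  ⨆ i, x i * ⨆ j, A i j * x j

theorem maxQuad_nonneg {A : Matrix I I ℝ} (hA : Nonneg A) {x : I → ℝ} (hx : ∀ i, 0 ≤ x i) :
    0 ≤ maxQuad A x :=
  Real.iSup_nonneg fun i => mul_nonneg (hx i) <| Real.iSup_nonneg fun j =>
    mul_nonneg (hA i j) (hx j)

theorem maxQuad_le {A : Matrix I I ℝ} {x : I → ℝ} (hx : ∀ i, 0 ≤ x i) {r : ℝ} (hr : 0 ≤ r)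
    (h : ∀ i j, x i * (A i j * x j) ≤ r) : maxQuad A x ≤ r := by
  refine Real.iSup_le (fun i => ?_) hr
  rw [Real.mul_iSup_of_nonneg (hx i)]
  exact Real.iSup_le (h i) hr

variable [Fintype I]

theorem mem_WMax {A : Matrix I I ℝ} {r : ℝ} :
    r ∈ WMax A ↔ ∃ x : I → ℝ, (∀ i, 0 ≤ x i) ∧ ⨆ i, x i * x i = 1 ∧ r = maxQuad A x := by
  constructor
  · rintro ⟨x, hx, h1, rfl⟩
    exact ⟨fun i => x i 0, fun i => hx i 0, congrFun (congrFun h1 0) 0, rfl⟩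
  · rintro ⟨x, hx, h1, rfl⟩
    refine ⟨Matrix.of fun i _ => x i, fun i _ => hx i, ?_, rfl⟩
    ext a b
    rw [Subsingleton.elim a b, Matrix.one_apply_eq]
    exact h1

theorem le_maxQuad {A : Matrix I I ℝ} {x : I → ℝ} (hx : ∀ i, 0 ≤ x i) (i j : I) :
    x i * (A i j * x j) ≤ maxQuad A x :=
  (mul_le_mul_of_nonneg_left (le_ciSup (f := fun j => A i j * x j)
    (Set.finite_range _).bddAbove j) (hx i)).trans
    (le_ciSup (f := fun i => x i * ⨆ j, A i j * x j) (Set.finite_range _).bddAbove i)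

theorem le_one_of_iSup_mul_self {x : I → ℝ} (h : ⨆ i, x i * x i = 1) (i : I) : x i ≤ 1 := by
  have := le_ciSup (f := fun i => x i * x i) (Set.finite_range _).bddAbove i
  rw [h] at this
  nlinarith

theorem iSup_mul_self_eq_one {x : I → ℝ} (hx : ∀ i, 0 ≤ x i) (h : ∀ i, x i ≤ 1) {i : I}
    (hi : x i = 1) : ⨆ i, x i * x i = 1 := by
  refine le_antisymm (Real.iSup_le (fun j => mul_le_one₀ (h j) (hx j) (h j)) zero_le_one) ?_
  have := le_ciSup (f := fun i => x i * x i) (Set.finite_range _).bddAbove i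
  simpa [hi] using this

theorem exists_eq_one_of_iSup_mul_self {x : I → ℝ} (hx : ∀ i, 0 ≤ x i)
    (h : ⨆ i, x i * x i = 1) : ∃ i, x i = 1 := by
  have : Nonempty I := by
    by_contra hI
    rw [not_nonempty_iff] at hI
    simp at h
  obtain ⟨i, hi⟩ := exists_eq_ciSup_of_finite (f := fun i => x i * x i)
  refine ⟨i, ?_⟩
  have := hx i
  simp only [h] at hi
  nlinarith

theorem maxQuad_mono {A : Matrix I I ℝ} (hA : Nonneg A) {x y : I → ℝ} (hx : ∀ i, 0 ≤ x i)
    (hxy : ∀ i, x i ≤ y i) : maxQuad A x ≤ maxQuad A y := by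
  have hy i := (hx i).trans (hxy i)
  refine maxQuad_le hx (maxQuad_nonneg hA hy) fun i j => le_trans ?_ (le_maxQuad hy i j)
  exact mul_le_mul (hxy i) (mul_le_mul_of_nonneg_left (hxy j) (hA i j))
    (mul_nonneg (hA i j) (hx j)) (hy i)

theorem continuous_iSup_of_finite {T : Type*} [TopologicalSpace T] [Nonempty I]
    {f : I → T → ℝ} (hf : ∀ i, Continuous (f i)) : Continuous fun t => ⨆ i, f i t := by
  simp only [← Finset.sup'_univ_eq_ciSup]
  exact Continuous.finset_sup'_apply _ fun i _ => hf i

/-- Every value between `xᵗ ⊗ A ⊗ x` and the value at the all-ones vector lies in the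
max numerical range. -/
theorem mem_WMax_of_mem_Icc {A : Matrix I I ℝ} {x : I → ℝ} (hx : ∀ i, 0 ≤ x i)
    (h1 : ⨆ i, x i * x i = 1) {r : ℝ} (hr : r ∈ Set.Icc (maxQuad A x) (maxQuad A fun _ => 1)) :
    r ∈ WMax A := by
  obtain ⟨i, hi⟩ := exists_eq_one_of_iSup_mul_self hx h1
  have : Nonempty I := ⟨i⟩
  have hle := le_one_of_iSup_mul_self h1
  have hc : Continuous fun t : ℝ => maxQuad A fun i => max (x i) t :=
    continuous_iSup_of_finite fun i => by
      refine Continuous.mul (by fun_prop) (continuous_iSup_of_finite fun j => by fun_prop)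
  have h0 : (fun i => max (x i) 0) = x := funext fun i => max_eq_left (hx i)
  have h2 : (fun i => max (x i) 1) = fun _ => 1 := funext fun i => max_eq_right (hle i)
  obtain ⟨t, ht, rfl⟩ := intermediate_value_Icc zero_le_one hc.continuousOn
    (show r ∈ Set.Icc _ _ by simpa only [h0, h2] using hr)
  exact mem_WMax.2 ⟨_, fun i => le_max_of_le_left (hx i),
    iSup_mul_self_eq_one (fun i => le_max_of_le_left (hx i)) (fun i => max_le (hle i) ht.2)
      (by rw [hi]; exact max_eq_left ht.2), rfl⟩

theorem WMaxK_subset_WMax {m : ℕ} (hm : 1 ≤ m) (A : Matrix I I ℝ) : WMaxK m A ⊆ WMax A := by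
  rintro _ ⟨X, ⟨hX, h1⟩, rfl⟩
  have : Nonempty (Fin m) := ⟨⟨0, hm⟩⟩
  obtain ⟨j, hj⟩ := exists_eq_ciSup_of_finite
    (f := fun j => maxMul Xᵀ (maxMul A X) j j)
  refine mem_WMax.2 ⟨fun i => X i j, fun i => hX i j, ?_, hj.symm⟩
  exact (congrFun (congrFun h1 j) j).trans (Matrix.one_apply_eq j)

theorem maxQuad_one_le {J : Type*} [Fintype J] [Nonempty I] {A : Matrix I I ℝ}
    {B : Matrix J J ℝ} (hB : Nonneg B) (h : WMax A = WMax B) :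
    maxQuad A (fun _ => 1) ≤ maxQuad B (fun _ => 1) := by
  have hm : maxQuad A (fun _ => 1) ∈ WMax B := h ▸ mem_WMax.2 ⟨_, by simp, by simp, rfl⟩
  obtain ⟨y, hy, hy1, hr⟩ := mem_WMax.1 hm
  exact hr ▸ maxQuad_mono hB hy (le_one_of_iSup_mul_self hy1)

end MaxQuad

section BlockDiagonal

variable {ι : Type*} [DecidableEq ι] {n : ι → Type*} {A : ∀ i, Matrix (n i) (n i) ℝ}

theorem Nonneg.blockDiagonal' (hA : ∀ i, Nonneg (A i)) : Nonneg (Matrix.blockDiagonal' A) := by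
  rintro ⟨i, a⟩ ⟨j, b⟩
  by_cases h : i = j
  · subst h
    simpa using hA i a b
  · simp [Matrix.blockDiagonal'_apply_ne _ _ _ h]

variable [Fintype ι] [∀ i, Fintype (n i)]

theorem maxQuad_blockDiagonal' (hA : ∀ i, Nonneg (A i)) {x : (Σ i, n i) → ℝ}
    (hx : ∀ p, 0 ≤ x p) :
    maxQuad (Matrix.blockDiagonal' A) x = ⨆ i, maxQuad (A i) fun a => x ⟨i, a⟩ := by
  have h0 : ∀ i, 0 ≤ maxQuad (A i) fun a => x ⟨i, a⟩ := fun i =>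
    maxQuad_nonneg (hA i) fun a => hx _
  refine le_antisymm (maxQuad_le hx (Real.iSup_nonneg h0) ?_) (Real.iSup_le (fun i => ?_)
    (maxQuad_nonneg (Nonneg.blockDiagonal' hA) hx))
  · rintro ⟨i, a⟩ ⟨j, b⟩
    by_cases h : i = j
    · subst h
      rw [Matrix.blockDiagonal'_apply_eq]
      exact (le_maxQuad (A := A i) (x := fun a => x ⟨i, a⟩) (fun a => hx _) a b).trans
        (le_ciSup (f := fun i => maxQuad (A i) fun a => x ⟨i, a⟩)
          (Set.finite_range _).bddAbove i)
    · rw [Matrix.blockDiagonal'_apply_ne _ _ _ h]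
      simpa using Real.iSup_nonneg h0
  · refine maxQuad_le (fun a => hx _) (maxQuad_nonneg (Nonneg.blockDiagonal' hA) hx)
      fun a b => ?_
    simpa using le_maxQuad (A := Matrix.blockDiagonal' A) hx ⟨i, a⟩ ⟨i, b⟩

theorem WMax_blockDiagonal'_subset [∀ i, Nonempty (n i)] (hA : ∀ i, Nonneg (A i))
    (hW : ∀ i j, WMax (A i) = WMax (A j)) (i : ι) :
    WMax (Matrix.blockDiagonal' A) ⊆ WMax (A i) := by
  intro r hr
  obtain ⟨x, hx, h1, rfl⟩ := mem_WMax.1 hr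
  have hle := le_one_of_iSup_mul_self h1
  obtain ⟨⟨j, a⟩, hj⟩ := exists_eq_one_of_iSup_mul_self hx h1
  rw [hW i j, maxQuad_blockDiagonal' hA hx]
  refine mem_WMax_of_mem_Icc (x := fun a => x ⟨j, a⟩) (fun a => hx _)
    (iSup_mul_self_eq_one (fun a => hx _) (fun a => hle _) hj)
    ⟨le_ciSup (f := fun i => maxQuad (A i) fun a => x ⟨i, a⟩) (Set.finite_range _).bddAbove j,
      Real.iSup_le (fun l => ?_) (maxQuad_nonneg (hA j) fun _ => zero_le_one)⟩
  exact (maxQuad_mono (hA l) (fun a => hx _) fun a => hle _).trans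
    (maxQuad_one_le (hA j) (hW l j))

/-- A value common to the ranges of the blocks is attained by an isometry whose columns are
supported in distinct blocks. -/
theorem mem_WMaxK_blockDiagonal' (hA : ∀ i, Nonneg (A i)) {r : ℝ}
    (hr : ∀ i, r ∈ WMax (A i)) {m : ℕ} (hm : 1 ≤ m) (e : Fin m ↪ ι) :
    r ∈ WMaxK m (Matrix.blockDiagonal' A) := by
  choose y hy hy1 hyr using fun i => mem_WMax.1 (hr i)
  have : Nonempty (Fin m) := ⟨⟨0, hm⟩⟩
  have hr0 : 0 ≤ r := hyr (e ⟨0, hm⟩) ▸ maxQuad_nonneg (hA _) (hy _)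
  let X : Matrix (Σ i, n i) (Fin m) ℝ := fun p j => if p.1 = e j then y p.1 p.2 else 0
  have hX : Nonneg X := fun p j => by
    dsimp only [X]
    split_ifs
    exacts [hy _ _, le_rfl]
  refine ⟨X, ⟨hX, ?_⟩, ?_⟩
  · ext j l
    change ⨆ p, X p j * X p l = _
    by_cases h : j = l
    · subst h
      obtain ⟨a, ha⟩ := exists_eq_one_of_iSup_mul_self (hy (e j)) (hy1 (e j))
      rw [Matrix.one_apply_eq]
      refine iSup_mul_self_eq_one (i := ⟨e j, a⟩) (fun p => hX p j) (fun p => ?_) (by simp [X, ha])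
      dsimp only [X]
      split_ifs
      exacts [le_one_of_iSup_mul_self (hy1 _) _, zero_le_one]
    · have h0 : ∀ p, X p j * X p l = 0 := fun p => by
        by_cases hp : p.1 = e j
        · have : p.1 ≠ e l := fun hl => h (e.injective (hp.symm.trans hl))
          simp [X, this]
        · simp [X, hp]
      simp [h0, Matrix.one_apply_ne h]
  · have h : ∀ j, maxQuad (Matrix.blockDiagonal' A) (fun p => X p j) = r := fun j => by
      rw [maxQuad_blockDiagonal' hA fun p => hX p j]
      refine le_antisymm (Real.iSup_le (fun i => ?_) hr0) ?_
      · by_cases hi : i = e j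
        · simp [X, hi, ← hyr]
        · simpa [X, hi, maxQuad] using hr0
      · have := le_ciSup (f := fun i => maxQuad (A i) fun a => X ⟨i, a⟩ j)
          (Set.finite_range _).bddAbove (e j)
        refine le_trans (le_of_eq ?_) this
        simp [X, ← hyr]
    change r = ⨆ j, maxQuad (Matrix.blockDiagonal' A) (fun p => X p j)
    simp [h]

end BlockDiagonal

/-- for a block diagonal `A = diag(A₁, …, A_k)` with
`W_max(A₁) = … = W_max(A_k)` and `1 ≤ k < n`, one has `W_max(A) = W_max^k(A)`,
and consequently `W_max(A) = W_max^m(A)` for all `1 ≤ m ≤ k`. -/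
theorem wmax_eq_wmaxK_blockDiagonal {k : ℕ} (hk1 : 1 ≤ k)
    (ns : Fin k → ℕ) (hns : ∀ i, 0 < ns i) (hkn : k < ∑ i, ns i)
    (A : ∀ i : Fin k, Matrix (Fin (ns i)) (Fin (ns i)) ℝ) (hA : ∀ i, Nonneg (A i))
    (hW : ∀ i j : Fin k, WMax (A i) = WMax (A j)) :
    WMax (Matrix.blockDiagonal' A) = WMaxK k (Matrix.blockDiagonal' A) ∧
    ∀ m : ℕ, 1 ≤ m → m ≤ k →
      WMax (Matrix.blockDiagonal' A) = WMaxK m (Matrix.blockDiagonal' A) := by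
  have (i : Fin k) : Nonempty (Fin (ns i)) := ⟨⟨0, hns i⟩⟩
  have key : ∀ m : ℕ, 1 ≤ m → m ≤ k →
      WMax (Matrix.blockDiagonal' A) = WMaxK m (Matrix.blockDiagonal' A) := fun m hm hmk =>
    Set.Subset.antisymm
      (fun _ hr => mem_WMaxK_blockDiagonal' hA
        (fun i => WMax_blockDiagonal'_subset hA hW i hr) hm (Fin.castLEEmb hmk))
      (WMaxK_subset_WMax hm _)
  exact ⟨key k hk1 le_rfl, key⟩

end MaxAlg
end

section
/- Let 𝔸 = (A₁, …, A_m), where A_l = (a^{(l)}_{ij}) ∈ M_n(ℝ₊) for l = 1, …, m, and let 1 ≤ k < n. Then W_max^k(𝔸) ⊆ [s₁, t₁] × … × [s_m, t_m] ⊆ ℝ₊^m, where s_l = min{ max_{1≤j≤k} a^{(l)}_{i_j i_j} : 1 ≤ i₁ < i₂ < … < i_k ≤ n } and t_l = max_{1≤i,j≤n} a^{(l)}_{ij} for each l. Moreover, W_max^n(𝔸) = {(tr_⊗(A₁), …, tr_⊗(A_m))}. -/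
open Matrix

namespace MaxAlg

variable {I J K : Type*}

lemma le_maxMul [Fintype J] (A : Matrix I J ℝ) (B : Matrix J K ℝ) (i : I) (j : J) (k : K) :
    A i j * B j k ≤ maxMul A B i k :=
  le_ciSup (f := fun j => A i j * B j k) (Set.finite_range _).bddAbove j

lemma maxMul_le [Fintype J] [Nonempty J] {A : Matrix I J ℝ} {B : Matrix J K ℝ} {i : I} {k : K}
    {c : ℝ} (h : ∀ j, A i j * B j k ≤ c) : maxMul A B i k ≤ c :=
  ciSup_le h

lemma le_maxTrace [Finite I] (M : Matrix I I ℝ) (i : I) : M i i ≤ maxTrace M :=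
  le_ciSup (f := fun i => M i i) (Set.finite_range _).bddAbove i

lemma maxTrace_conj_le [Fintype I] [Nonempty I] [Nonempty J] {A : Matrix I I ℝ}
    {X : Matrix I J ℝ} (hX : Nonneg X) {c : ℝ}
    (h : ∀ i p j, X i j * (A i p * X p j) ≤ c) :
    maxTrace (maxMul Xᵀ (maxMul A X)) ≤ c := by
  refine ciSup_le fun j => maxMul_le fun i => ?_
  change X i j * (⨆ p, A i p * X p j) ≤ c
  rw [Real.mul_iSup_of_nonneg (hX i j)]
  exact ciSup_le fun p => h i p j

lemma le_maxTrace_conj [Fintype I] [Finite J] (A : Matrix I I ℝ)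
    {X : Matrix I J ℝ} (hX : Nonneg X) (i p : I) (j : J) :
    X i j * (A i p * X p j) ≤ maxTrace (maxMul Xᵀ (maxMul A X)) :=
  (mul_le_mul_of_nonneg_left (le_maxMul A X i p j) (hX i j)).trans
    ((le_maxMul Xᵀ (maxMul A X) j i j).trans (le_maxTrace _ j))

namespace IsMaxIsometry

variable [Fintype I] [Fintype J] [DecidableEq J] {X : Matrix I J ℝ}

lemma le_one (hX : IsMaxIsometry X) (i : I) (j : J) : X i j ≤ 1 := by
  have h := le_maxMul Xᵀ X j i j
  rw [hX.2, one_apply_eq, transpose_apply] at h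
  nlinarith [hX.1 i j]

lemma mul_eq_zero (hX : IsMaxIsometry X) (i : I) {j j' : J} (hj : j ≠ j') :
    X i j * X i j' = 0 := by
  have h := le_maxMul Xᵀ X j i j'
  rw [hX.2, one_apply_ne hj, transpose_apply] at h
  exact le_antisymm h (mul_nonneg (hX.1 i j) (hX.1 i j'))

/-- Every column of a max isometry has an entry equal to `1`, and these entries lie in
distinct rows. -/
lemma exists_injective [Nonempty I] (hX : IsMaxIsometry X) :
    ∃ σ : J → I, Function.Injective σ ∧ ∀ j, X (σ j) j = 1 := by
  have h1 (j : J) : ∃ i, X i j = 1 := by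
    obtain ⟨i, hi⟩ := exists_eq_ciSup_of_finite (f := fun i => X i j * X i j)
    have h : (⨆ i, X i j * X i j) = 1 := by
      simpa [maxMul] using congrFun (congrFun hX.2 j) j
    refine ⟨i, ?_⟩
    have h2 : X i j * X i j = 1 := hi.trans h
    nlinarith [hX.1 i j]
  choose σ hσ using h1
  refine ⟨σ, fun j j' h => ?_, hσ⟩
  by_contra hj
  have h0 := hX.mul_eq_zero (σ j) hj
  rw [hσ j, h, hσ j'] at h0
  norm_num at h0

lemma diag_le_maxTrace_conj (hX : IsMaxIsometry X) (A : Matrix I I ℝ) {i : I} {j : J}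
    (h : X i j = 1) : A i i ≤ maxTrace (maxMul Xᵀ (maxMul A X)) := by
  simpa [h] using le_maxTrace_conj A hX.1 i i j

end IsMaxIsometry

lemma isMaxIsometry_one [Fintype I] [Nonempty I] [DecidableEq I] :
    IsMaxIsometry (1 : Matrix I I ℝ) := by
  refine ⟨fun i j => ?_, ?_⟩
  · rw [one_apply]
    split_ifs <;> norm_num
  · ext i k
    apply le_antisymm
    · refine maxMul_le fun j => ?_
      rw [transpose_apply]
      by_cases hij : j = i
      · rw [hij, one_apply_eq, one_mul]
      · rw [one_apply_ne hij, zero_mul, one_apply]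
        split_ifs <;> norm_num
    · simpa only [transpose_apply, one_apply_eq, one_mul] using
        le_maxMul (1 : Matrix I I ℝ)ᵀ 1 i i k

lemma IsMaxIsometry.maxTrace_conj_eq [Fintype I] [Nonempty I] [DecidableEq I]
    {X : Matrix I I ℝ} (hX : IsMaxIsometry X) {A : Matrix I I ℝ} (hA : Nonneg A) :
    maxTrace (maxMul Xᵀ (maxMul A X)) = maxTrace A := by
  obtain ⟨σ, hσ, h1⟩ := hX.exists_injective
  have hsurj : Function.Surjective σ := Finite.surjective_of_injective hσ
  have h0 (i j : I) (h : i ≠ σ j) : X i j = 0 := by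
    obtain ⟨j', rfl⟩ := hsurj i
    simpa [h1] using hX.mul_eq_zero (σ j') (fun e : j = j' => h (e ▸ rfl))
  have hnn : 0 ≤ maxTrace A := Real.iSup_nonneg fun i => hA i i
  apply le_antisymm
  · refine maxTrace_conj_le hX.1 fun i p j => ?_
    by_cases hi : i = σ j
    · by_cases hp : p = σ j
      · simpa [hi, hp, h1] using le_maxTrace A (σ j)
      · simpa [h0 p j hp] using hnn
    · simpa [h0 i j hi] using hnn
  · refine ciSup_le fun i => ?_
    obtain ⟨j, rfl⟩ := hsurj i
    exact hX.diag_le_maxTrace_conj A (h1 j)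

lemma IsMaxIsometry.maxTrace_conj_le_iSup [Fintype I] [Nonempty I] [Fintype J] [Nonempty J]
    [DecidableEq J] {X : Matrix I J ℝ} (hX : IsMaxIsometry X) {A : Matrix I I ℝ}
    (hA : Nonneg A) : maxTrace (maxMul Xᵀ (maxMul A X)) ≤ ⨆ i, ⨆ j, A i j := by
  refine maxTrace_conj_le hX.1 fun i p j => ?_
  calc X i j * (A i p * X p j) ≤ A i p * X p j :=
        mul_le_of_le_one_left (mul_nonneg (hA i p) (hX.1 p j)) (hX.le_one i j)
    _ ≤ A i p := mul_le_of_le_one_right (hA i p) (hX.le_one p j)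
    _ ≤ ⨆ q, A i q := le_ciSup (f := fun q => A i q) (Set.finite_range _).bddAbove p
    _ ≤ ⨆ i, ⨆ q, A i q :=
        le_ciSup (f := fun i => ⨆ q, A i q) (Set.finite_range _).bddAbove i

/-- An injective tuple of indices can be sorted without changing its range. -/
lemma exists_strictMono_range_eq [LinearOrder I] {k : ℕ} {σ : Fin k → I}
    (hσ : Function.Injective σ) :
    ∃ f : Fin k → I, StrictMono f ∧ Set.range f = Set.range σ := by
  have hc : (Finset.univ.image σ).card = k := by
    rw [Finset.card_image_of_injective _ hσ, Finset.card_univ, Fintype.card_fin]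
  exact ⟨(Finset.univ.image σ).orderEmbOfFin hc, OrderEmbedding.strictMono _, by simp⟩

lemma IsMaxIsometry.iInf_le_maxTrace_conj [Fintype I] [Nonempty I] [LinearOrder I] {k : ℕ}
    [NeZero k] {X : Matrix I (Fin k) ℝ} (hX : IsMaxIsometry X) (A : Matrix I I ℝ) :
    (⨅ f : {f : Fin k → I // StrictMono f}, ⨆ j, A (f.1 j) (f.1 j)) ≤
      maxTrace (maxMul Xᵀ (maxMul A X)) := by
  obtain ⟨σ, hσ, h1⟩ := hX.exists_injective
  obtain ⟨f, hf, hr⟩ := exists_strictMono_range_eq hσ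
  refine (ciInf_le (Set.finite_range _).bddBelow ⟨f, hf⟩).trans (ciSup_le fun j => ?_)
  obtain ⟨j', hj'⟩ : f j ∈ Set.range σ := hr ▸ Set.mem_range_self j
  simp only [← hj']
  exact hX.diag_le_maxTrace_conj A (h1 j')

/-- `W_max^k(𝔸) ⊆ [s₁,t₁] × … × [s_m,t_m]` for `1 ≤ k < n`, and
`W_max^n(𝔸) = {(tr_⊗(A₁), …, tr_⊗(A_m))}`. -/
theorem wmaxKJoint_subset_pi_Icc {n m : ℕ} (hn : 0 < n)
    (A : Fin m → Matrix (Fin n) (Fin n) ℝ) (hA : ∀ l, Nonneg (A l))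
    {k : ℕ} (hk1 : 1 ≤ k) (hkn : k < n) :
    WMaxKJoint k A ⊆ Set.pi Set.univ (fun l => Set.Icc
        (⨅ f : {f : Fin k → Fin n // StrictMono f}, ⨆ j, A l (f.1 j) (f.1 j))
        (⨆ i, ⨆ j, A l i j)) ∧
    WMaxKJoint n A = {fun l => maxTrace (A l)} := by
  have : NeZero n := ⟨hn.ne'⟩
  have : NeZero k := ⟨by omega⟩
  refine ⟨?_, ?_⟩
  · rintro v ⟨X, hX, hv⟩ l -
    rw [hv l]
    exact ⟨hX.iInf_le_maxTrace_conj (A l), hX.maxTrace_conj_le_iSup (hA l)⟩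
  · ext v
    refine ⟨?_, ?_⟩
    · rintro ⟨X, hX, hv⟩
      exact funext fun l => (hv l).trans (hX.maxTrace_conj_eq (hA l))
    · rintro rfl
      exact ⟨1, isMaxIsometry_one, fun l => (isMaxIsometry_one.maxTrace_conj_eq (hA l)).symm⟩

end MaxAlg
end
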